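/- arXiv:2601.21417 — 6 statements merged into one kernel-verified Lean document; each statement's English description precedes it below -/
import Mathlib

section
/- Let K₁, K₂ : ℝ² × ℝ² → ℂ be JCEL kernels with localization constants (C₁, β₁) and (C₂, β₂) respectively. Then: (a) for every x, x' ∈ ℝ² the integral (K₁ ∘ K₂)(x,x') = ∫_{ℝ²} K₁(x,y)·K₂(y,x') dy converges absolutely; (b) the function (x,x') ↦ (K₁ ∘ K₂)(x,x') is jointly continuous on ℝ² × ℝ²; and (c) for every β' with 0 < β' < min(β₁, β₂) one has |exp(β'·‖x−x'‖)·(K₁ ∘ K₂)(x,x')| ≤ C₁·C₂·(∫_{ℝ²} exp(−(β₁−β')·‖y‖) dy)^{1/2}·(∫_{ℝ²} exp(−(β₂−β')·‖y‖) dy)^{1/2} for all x, x' ∈ ℝ². -/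
open MeasureTheory

noncomputable section

/-- The Euclidean plane `ℝ²`. -/
abbrev R2 : Type := EuclideanSpace ℝ (Fin 2)

/-- A kernel `K : ℝ² × ℝ² → ℂ` is *jointly continuous exponentially localized* (JCEL) with
localization constants `(C, β)` if it is jointly continuous and
`|K(x,x')| ≤ C·exp(−β·‖x−x'‖)` for all `x, x'`. -/
def JCEL (K : R2 × R2 → ℂ) (C β : ℝ) : Prop :=
  Continuous K ∧ ∀ x x' : R2, ‖K (x, x')‖ ≤ C * Real.exp (-β * ‖x - x'‖)

/-- Exponential decay in the norm is integrable on the Euclidean plane. -/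
lemma integrable_exp_neg_mul_norm {a : ℝ} (ha : 0 < a) :
    Integrable (fun y : R2 => Real.exp (-a * ‖y‖)) := by
  have h := (integrable_fun_norm_addHaar (volume : Measure R2)
    (f := fun r : ℝ => Real.exp (-a * r))).2
  apply h
  have h' := integrableOn_rpow_mul_exp_neg_mul_rpow (s := 1) (p := 1) (b := a)
    (by norm_num) one_pos ha
  simpa using h'

lemma integrable_exp_neg_mul_norm_sub {a : ℝ} (ha : 0 < a) (x : R2) :
    Integrable (fun y : R2 => Real.exp (-a * ‖x - y‖)) :=
  (integrable_exp_neg_mul_norm ha).comp_sub_left x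

/-- The Cauchy–Schwarz bound for the convolution of two exponentially decaying functions. -/
lemma integral_exp_mul_exp_le {a b : ℝ} (ha : 0 < a) (hb : 0 < b) (x x' : R2) :
    ∫ y : R2, Real.exp (-a * ‖x - y‖) * Real.exp (-b * ‖y - x'‖) ≤
      (∫ y : R2, Real.exp (-a * ‖y‖)) ^ ((1 : ℝ) / 2) *
        (∫ y : R2, Real.exp (-b * ‖y‖)) ^ ((1 : ℝ) / 2) := by
  have memLp_two : ∀ {c : ℝ}, 0 < c → ∀ z : R2,
      MemLp (fun y : R2 => Real.exp (-c * ‖z - y‖)) (ENNReal.ofReal 2) := by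
    intro c hc z
    rw [ENNReal.ofReal_ofNat, memLp_two_iff_integrable_sq (by fun_prop)]
    refine (integrable_exp_neg_mul_norm_sub (a := 2 * c) (by positivity) z).congr
      (.of_forall fun y => ?_)
    simp only [← Real.exp_nat_mul]
    congr 1
    push_cast
    ring
  have integral_le : ∀ {c : ℝ}, 0 < c → ∀ z : R2,
      ∫ y : R2, Real.exp (-c * ‖z - y‖) ^ (2 : ℝ) ≤ ∫ y : R2, Real.exp (-c * ‖y‖) := by
    intro c hc z
    rw [← integral_sub_left_eq_self (fun y : R2 => Real.exp (-c * ‖y‖)) volume z]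
    refine integral_mono_of_nonneg (.of_forall fun y => by positivity)
      (integrable_exp_neg_mul_norm_sub hc z) (.of_forall fun y => ?_)
    simp only [← Real.exp_mul]
    refine Real.exp_le_exp.2 ?_
    nlinarith [mul_nonneg hc.le (norm_nonneg (z - y))]
  have h := integral_mul_le_Lp_mul_Lq_of_nonneg (μ := (volume : Measure R2))
    Real.HolderConjugate.two_two
    (.of_forall fun y => (Real.exp_pos _).le) (.of_forall fun y => (Real.exp_pos _).le)
    (memLp_two ha x) (memLp_two hb x')
  simp only [norm_sub_rev _ x']
  refine h.trans ?_
  have rpow_le : ∀ {c : ℝ}, 0 < c → ∀ z : R2,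
      (∫ y : R2, Real.exp (-c * ‖z - y‖) ^ (2 : ℝ)) ^ ((1 : ℝ) / 2) ≤
        (∫ y : R2, Real.exp (-c * ‖y‖)) ^ ((1 : ℝ) / 2) := fun hc z =>
    Real.rpow_le_rpow (integral_nonneg fun y => by positivity) (integral_le hc z) (by norm_num)
  exact mul_le_mul (rpow_le ha x) (rpow_le hb x') (by positivity) (by positivity)

/-- A kernel that is exponentially localized is bounded. -/
lemma JCEL.norm_le {K : R2 × R2 → ℂ} {C β : ℝ} (h : JCEL K C β) (hC : 0 < C) (hβ : 0 < β)
    (x x' : R2) : ‖K (x, x')‖ ≤ C := by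
  refine (h.2 x x').trans (mul_le_of_le_one_right hC.le (Real.exp_le_one_iff.2 ?_))
  nlinarith [mul_nonneg hβ.le (norm_nonneg (x - x'))]

/-- Proposition A.2(ii). The composition of two JCEL kernels is everywhere
absolutely convergent, jointly continuous, and exponentially localized with any decay rate
`β' < min(β₁, β₂)`, with the explicit Cauchy–Schwarz bound. -/
theorem stmt_1 (K₁ K₂ : R2 × R2 → ℂ) (C₁ β₁ C₂ β₂ : ℝ)
    (hC₁ : 0 < C₁) (hβ₁ : 0 < β₁) (hC₂ : 0 < C₂) (hβ₂ : 0 < β₂)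
    (h₁ : JCEL K₁ C₁ β₁) (h₂ : JCEL K₂ C₂ β₂) :
    -- (a) absolute convergence of the composition integral
    (∀ x x' : R2, Integrable (fun y : R2 => K₁ (x, y) * K₂ (y, x'))) ∧
    -- (b) joint continuity of the composed kernel
    Continuous (fun p : R2 × R2 => ∫ y : R2, K₁ (p.1, y) * K₂ (y, p.2)) ∧
    -- (c) exponential localization with rate β' < min(β₁, β₂)
    (∀ β' : ℝ, 0 < β' → β' < min β₁ β₂ → ∀ x x' : R2,
      Real.exp (β' * ‖x - x'‖) * ‖∫ y : R2, K₁ (x, y) * K₂ (y, x')‖ ≤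
        C₁ * C₂ * (∫ y : R2, Real.exp (-(β₁ - β') * ‖y‖)) ^ ((1 : ℝ)/2) *
          (∫ y : R2, Real.exp (-(β₂ - β') * ‖y‖)) ^ ((1 : ℝ)/2)) := by
  have hK₁ := h₁.1
  have hK₂ := h₂.1
  refine ⟨fun x x' => ?_, ?_, fun β' _ hβ' x x' => ?_⟩
  · refine ((integrable_exp_neg_mul_norm_sub hβ₁ x).const_mul (C₁ * C₂)).mono'
      (by fun_prop) (.of_forall fun y => ?_)
    calc ‖K₁ (x, y) * K₂ (y, x')‖ = ‖K₁ (x, y)‖ * ‖K₂ (y, x')‖ := norm_mul _ _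
      _ ≤ (C₁ * Real.exp (-β₁ * ‖x - y‖)) * C₂ := by
        gcongr
        exacts [h₁.2 x y, h₂.norm_le hC₂ hβ₂ y x']
      _ = C₁ * C₂ * Real.exp (-β₁ * ‖x - y‖) := by ring
  · refine continuous_iff_continuousAt.2 fun p₀ => ?_
    refine continuousAt_of_dominated
      (bound := fun y => C₁ * C₂ * Real.exp β₁ * Real.exp (-β₁ * ‖p₀.1 - y‖))
      (.of_forall fun p => by fun_prop) ?_
      ((integrable_exp_neg_mul_norm_sub hβ₁ p₀.1).const_mul _)
      (.of_forall fun y => by fun_prop)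
    filter_upwards [Metric.ball_mem_nhds p₀ one_pos] with p hp
    refine .of_forall fun y => ?_
    have hp₁ : ‖p₀.1 - p.1‖ ≤ 1 := by
      rw [← dist_eq_norm, dist_comm]
      exact (le_max_left _ _).trans (Metric.mem_ball.1 hp).le
    have htri : ‖p₀.1 - y‖ ≤ 1 + ‖p.1 - y‖ :=
      (norm_sub_le_norm_sub_add_norm_sub p₀.1 p.1 y).trans (by gcongr)
    calc ‖K₁ (p.1, y) * K₂ (y, p.2)‖ = ‖K₁ (p.1, y)‖ * ‖K₂ (y, p.2)‖ := norm_mul _ _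
      _ ≤ (C₁ * Real.exp (-β₁ * ‖p.1 - y‖)) * C₂ := by
        gcongr
        exacts [h₁.2 p.1 y, h₂.norm_le hC₂ hβ₂ y p.2]
      _ ≤ (C₁ * Real.exp (β₁ + -β₁ * ‖p₀.1 - y‖)) * C₂ := by
        gcongr
        nlinarith [mul_le_mul_of_nonneg_left htri hβ₁.le]
      _ = C₁ * C₂ * Real.exp β₁ * Real.exp (-β₁ * ‖p₀.1 - y‖) := by
        rw [Real.exp_add]
        ring
  · have ha : 0 < β₁ - β' := sub_pos.2 (hβ'.trans_le (min_le_left _ _))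
    have hb : 0 < β₂ - β' := sub_pos.2 (hβ'.trans_le (min_le_right _ _))
    have hint : Integrable fun y : R2 =>
        Real.exp (-(β₁ - β') * ‖x - y‖) * Real.exp (-(β₂ - β') * ‖y - x'‖) := by
      refine (integrable_exp_neg_mul_norm_sub ha x).mono' (by fun_prop) (.of_forall fun y => ?_)
      rw [Real.norm_of_nonneg (by positivity)]
      refine mul_le_of_le_one_right (Real.exp_pos _).le (Real.exp_le_one_iff.2 ?_)
      nlinarith [mul_nonneg hb.le (norm_nonneg (y - x'))]
    have hpt : ∀ y : R2, ‖K₁ (x, y) * K₂ (y, x')‖ ≤ Real.exp (-β' * ‖x - x'‖) * (C₁ * C₂) *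
        (Real.exp (-(β₁ - β') * ‖x - y‖) * Real.exp (-(β₂ - β') * ‖y - x'‖)) := by
      intro y
      have htri := norm_sub_le_norm_sub_add_norm_sub x y x'
      calc ‖K₁ (x, y) * K₂ (y, x')‖ = ‖K₁ (x, y)‖ * ‖K₂ (y, x')‖ := norm_mul _ _
        _ ≤ (C₁ * Real.exp (-β₁ * ‖x - y‖)) * (C₂ * Real.exp (-β₂ * ‖y - x'‖)) := by
          gcongr
          exacts [h₁.2 x y, h₂.2 y x']
        _ = C₁ * C₂ * Real.exp (-β₁ * ‖x - y‖ + -β₂ * ‖y - x'‖) := by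
          rw [Real.exp_add]
          ring
        _ ≤ C₁ * C₂ * Real.exp (-β' * ‖x - x'‖ +
            (-(β₁ - β') * ‖x - y‖ + -(β₂ - β') * ‖y - x'‖)) := by
          refine mul_le_mul_of_nonneg_left (Real.exp_le_exp.2 ?_) (by positivity)
          nlinarith
        _ = _ := by
          rw [Real.exp_add, Real.exp_add]
          ring
    have hnorm := norm_integral_le_of_norm_le (hint.const_mul _) (.of_forall hpt)
    rw [integral_const_mul] at hnorm
    calc Real.exp (β' * ‖x - x'‖) * ‖∫ y : R2, K₁ (x, y) * K₂ (y, x')‖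
        ≤ Real.exp (β' * ‖x - x'‖) * (Real.exp (-β' * ‖x - x'‖) * (C₁ * C₂) *
          ∫ y : R2, Real.exp (-(β₁ - β') * ‖x - y‖) * Real.exp (-(β₂ - β') * ‖y - x'‖)) := by
          gcongr
      _ = C₁ * C₂ *
          ∫ y : R2, Real.exp (-(β₁ - β') * ‖x - y‖) * Real.exp (-(β₂ - β') * ‖y - x'‖) := by
          rw [← mul_assoc, ← mul_assoc, ← Real.exp_add]
          simp
      _ ≤ C₁ * C₂ * ((∫ y : R2, Real.exp (-(β₁ - β') * ‖y‖)) ^ ((1 : ℝ) / 2) *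
          (∫ y : R2, Real.exp (-(β₂ - β') * ‖y‖)) ^ ((1 : ℝ) / 2)) := by
          gcongr
          exact integral_exp_mul_exp_le ha hb x x'
      _ = _ := by ring
end
end

section
/- Let K : ℝ² × ℝ² → ℂ be a JCEL kernel with localization constants (C, β). Define the iterated kernels K⁽¹⁾ := K and K⁽ⁿ⁺¹⁾(x,x') := ∫_{ℝ²} K(x,y)·K⁽ⁿ⁾(y,x') dy. Fix β' with 0 < β' < β and set M := ∫_{ℝ²} exp(−(β−β')·‖y‖) dy. Then for every n ≥ 1 and all x, x' ∈ ℝ², the defining integrals converge absolutely and |K⁽ⁿ⁾(x,x')| ≤ C·(C·M)^{n−1}·exp(−β'·‖x−x'‖). -/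
open MeasureTheory

noncomputable section

/-- Iterated kernels: `iterK K 0 = K = K⁽¹⁾` and
`iterK K (n+1) (x,x') = ∫ K(x,y) · (iterK K n)(y,x') dy = K⁽ⁿ⁺²⁾(x,x')`. -/
noncomputable def iterK (K : R2 × R2 → ℂ) : ℕ → R2 × R2 → ℂ
  | 0 => K
  | n + 1 => fun p => ∫ y : R2, K (p.1, y) * iterK K n (y, p.2)

lemma stronglyMeasurable_iterK {K : R2 × R2 → ℂ} (hK : Continuous K) (n : ℕ) :
    StronglyMeasurable (iterK K n) := by
  induction n with
  | zero => exact hK.stronglyMeasurable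
  | succ n ih =>
    refine StronglyMeasurable.integral_prod_right
      (f := fun (p : R2 × R2) (y : R2) => K (p.1, y) * iterK K n (y, p.2)) ?_
    exact (hK.stronglyMeasurable.comp_measurable
        (g := fun q : (R2 × R2) × R2 => (q.1.1, q.2)) (by fun_prop)).mul
      (ih.comp_measurable (g := fun q : (R2 × R2) × R2 => (q.2, q.1.2)) (by fun_prop))

lemma exp_neg_mul_norm_mul_le {β β' : ℝ} (hβ' : 0 ≤ β') (x y x' : R2) :
    Real.exp (-β * ‖x - y‖) * Real.exp (-β' * ‖y - x'‖) ≤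
      Real.exp (-β' * ‖x - x'‖) * Real.exp (-(β - β') * ‖x - y‖) := by
  rw [← Real.exp_add, ← Real.exp_add, Real.exp_le_exp]
  nlinarith [mul_le_mul_of_nonneg_left (norm_sub_le_norm_sub_add_norm_sub x y x') hβ']

/-- key estimate for Proposition A.2(iii). For a JCEL kernel `K` with
constants `(C, β)`, any `0 < β' < β`, and `M := ∫ exp(−(β−β')·‖y‖) dy`, the iterated kernels
`K⁽ⁿ⁾ = iterK K (n−1)` have absolutely convergent defining integrals and satisfy
`|K⁽ⁿ⁾(x,x')| ≤ C·(C·M)^{n−1}·exp(−β'·‖x−x'‖)`. -/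
theorem stmt_2 (K : R2 × R2 → ℂ) (C β : ℝ) (hC : 0 < C) (hβ : 0 < β)
    (hK : JCEL K C β) (β' : ℝ) (hβ'pos : 0 < β') (hβ'lt : β' < β)
    (M : ℝ) (hM : M = ∫ y : R2, Real.exp (-(β - β') * ‖y‖)) :
    ∀ n : ℕ,
      (∀ x x' : R2, Integrable (fun y : R2 => K (x, y) * iterK K n (y, x'))) ∧
      (∀ x x' : R2,
        ‖iterK K n (x, x')‖ ≤ C * (C * M) ^ n * Real.exp (-β' * ‖x - x'‖)) := by
  have hint := integrable_exp_neg_mul_norm (sub_pos.2 hβ'lt)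
  have hM0 : 0 ≤ M := hM ▸ integral_nonneg fun y => (Real.exp_pos _).le
  have hint' (x : R2) : Integrable (fun y : R2 => Real.exp (-(β - β') * ‖x - y‖)) :=
    hint.comp_sub_left x
  have hprod (D : ℝ) (n : ℕ) (hD : 0 ≤ D)
      (h : ∀ x x' : R2, ‖iterK K n (x, x')‖ ≤ D * Real.exp (-β' * ‖x - x'‖)) (x x' y : R2) :
      ‖K (x, y) * iterK K n (y, x')‖ ≤
        C * D * Real.exp (-β' * ‖x - x'‖) * Real.exp (-(β - β') * ‖x - y‖) := by
    rw [norm_mul]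
    calc ‖K (x, y)‖ * ‖iterK K n (y, x')‖
        ≤ (C * Real.exp (-β * ‖x - y‖)) * (D * Real.exp (-β' * ‖y - x'‖)) := by
          gcongr
          exacts [hK.2 x y, h y x']
      _ = C * D * (Real.exp (-β * ‖x - y‖) * Real.exp (-β' * ‖y - x'‖)) := by ring
      _ ≤ C * D * (Real.exp (-β' * ‖x - x'‖) * Real.exp (-(β - β') * ‖x - y‖)) := by
          gcongr C * D * ?_
          exact exp_neg_mul_norm_mul_le hβ'pos.le x y x'
      _ = _ := by ring
  have hbound (n : ℕ) (x x' : R2) :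
      ‖iterK K n (x, x')‖ ≤ C * (C * M) ^ n * Real.exp (-β' * ‖x - x'‖) := by
    induction n generalizing x x' with
    | zero =>
      rw [pow_zero, mul_one]
      refine (hK.2 x x').trans ?_
      gcongr
    | succ n ih =>
      refine (norm_integral_le_of_norm_le ((hint' x).const_mul _)
        (.of_forall (hprod _ n (by positivity) ih x x'))).trans_eq ?_
      rw [integral_const_mul,
        integral_sub_left_eq_self (fun y : R2 => Real.exp (-(β - β') * ‖y‖)) volume x, ← hM]
      ring
  refine fun n => ⟨fun x x' => ?_, hbound n⟩
  refine ((hint' x).const_mul _).mono' ?_ (.of_forall (hprod _ n (by positivity) (hbound n) x x'))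
  exact ((hK.1.comp (by fun_prop : Continuous fun y : R2 => (x, y))).stronglyMeasurable.mul
    ((stronglyMeasurable_iterK hK.1 n).comp_measurable
      (by fun_prop : Measurable fun y : R2 => (y, x')))).aestronglyMeasurable
end
end

section
/- Let K : ℝ² × ℝ² → ℂ be a JCEL kernel with localization constants (C, β), and let K⁽ⁿ⁾ denote its iterated kernels (K⁽¹⁾ := K, K⁽ⁿ⁺¹⁾(x,x') := ∫_{ℝ²} K(x,y)·K⁽ⁿ⁾(y,x') dy). Fix β' with 0 < β' < β and set M := ∫_{ℝ²} exp(−(β−β')·‖y‖) dy. Let (aₙ)_{n≥1} be complex coefficients with S := Σ_{n≥1} |aₙ|·C·(C·M)^{n−1} < ∞. Then the series F(x,x') := Σ_{n≥1} aₙ·K⁽ⁿ⁾(x,x') converges absolutely and uniformly on ℝ² × ℝ², the function F is jointly continuous, and |F(x,x')| ≤ S·exp(−β'·‖x−x'‖) for all x, x' ∈ ℝ². -/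
open MeasureTheory Filter

noncomputable section

/-- The radial exponential `exp (-c‖y‖)`, `c > 0`, is integrable on the plane. -/
lemma integrable_exp_neg_mul_norm_R2 {c : ℝ} (hc : 0 < c) :
    Integrable (fun y : R2 => Real.exp (-c * ‖y‖)) := by
  refine (integrable_fun_norm_addHaar (volume : Measure R2)
    (f := fun r : ℝ => Real.exp (-c * r))).2 ?_
  have h := integrableOn_rpow_mul_exp_neg_mul_rpow (s := 1) (p := 1) (by norm_num) one_pos hc
  simpa using h

lemma integrable_exp_neg_mul_norm_sub_R2 {c : ℝ} (hc : 0 < c) (x : R2) :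
    Integrable (fun y : R2 => Real.exp (-c * ‖x - y‖)) :=
  (integrable_exp_neg_mul_norm_R2 hc).comp_sub_left x

/-- Composing exponentially localized kernels with rates `β' < β` keeps the smaller rate. -/
lemma norm_mul_le_of_localized {K L : R2 × R2 → ℂ} {C B β β' : ℝ} (hB : 0 ≤ B) (hβ' : 0 ≤ β')
    (hK : ∀ x x' : R2, ‖K (x, x')‖ ≤ C * Real.exp (-β * ‖x - x'‖))
    (hL : ∀ x x' : R2, ‖L (x, x')‖ ≤ B * Real.exp (-β' * ‖x - x'‖)) (hC : 0 ≤ C)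
    (x y x' : R2) :
    ‖K (x, y) * L (y, x')‖ ≤
      C * B * Real.exp (-β' * ‖x - x'‖) * Real.exp (-(β - β') * ‖x - y‖) := by
  have htri : ‖x - x'‖ ≤ ‖x - y‖ + ‖y - x'‖ := norm_sub_le_norm_sub_add_norm_sub x y x'
  calc ‖K (x, y) * L (y, x')‖
      ≤ (C * Real.exp (-β * ‖x - y‖)) * (B * Real.exp (-β' * ‖y - x'‖)) := by
        rw [norm_mul]
        exact mul_le_mul (hK x y) (hL y x') (norm_nonneg _) (by positivity)
    _ = C * B * Real.exp (-β * ‖x - y‖ + -β' * ‖y - x'‖) := by rw [Real.exp_add]; ring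
    _ ≤ C * B * Real.exp (-β' * ‖x - x'‖ + -(β - β') * ‖x - y‖) := by
        refine mul_le_mul_of_nonneg_left (Real.exp_le_exp.2 ?_) (mul_nonneg hC hB)
        linarith [mul_le_mul_of_nonneg_left htri hβ']
    _ = _ := by rw [Real.exp_add]; ring

/-- The composition of two JCEL kernels with rates `β' < β` is JCEL with rate `β'`. -/
lemma JCEL.comp {K L : R2 × R2 → ℂ} {C B β β' : ℝ} (hC : 0 ≤ C) (hB : 0 ≤ B) (hβ' : 0 ≤ β')
    (hlt : β' < β) (hK : JCEL K C β) (hL : JCEL L B β') :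
    JCEL (fun p : R2 × R2 => ∫ y : R2, K (p.1, y) * L (y, p.2))
      (C * B * ∫ y : R2, Real.exp (-(β - β') * ‖y‖)) β' := by
  have hδ : 0 < β - β' := sub_pos.2 hlt
  have hbound := norm_mul_le_of_localized hB hβ' hK.2 hL.2 hC
  have hKc := hK.1
  have hLc := hL.1
  constructor
  · refine continuous_iff_continuousAt.2 fun p₀ => ?_
    refine continuousAt_of_dominated
      (bound := fun y => C * B * Real.exp (β - β') * Real.exp (-(β - β') * ‖p₀.1 - y‖))
      ?_ ?_ ?_ ?_
    · refine Eventually.of_forall fun p => Continuous.aestronglyMeasurable ?_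
      fun_prop
    · have hnear : ∀ᶠ p : R2 × R2 in nhds p₀, ‖p₀.1 - p.1‖ < 1 := by
        have hc : Continuous fun p : R2 × R2 => ‖p₀.1 - p.1‖ := by fun_prop
        exact hc.continuousAt.eventually_lt continuousAt_const (by simp)
      filter_upwards [hnear] with p hp
      refine Eventually.of_forall fun y => (hbound p.1 y p.2).trans ?_
      have htri : ‖p₀.1 - y‖ ≤ ‖p₀.1 - p.1‖ + ‖p.1 - y‖ :=
        norm_sub_le_norm_sub_add_norm_sub _ _ _
      rw [mul_assoc, mul_assoc (C * B), ← Real.exp_add, ← Real.exp_add]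
      refine mul_le_mul_of_nonneg_left (Real.exp_le_exp.2 ?_) (mul_nonneg hC hB)
      nlinarith [mul_nonneg hβ' (norm_nonneg (p.1 - p.2))]
    · exact (integrable_exp_neg_mul_norm_sub_R2 hδ p₀.1).const_mul _
    · refine Eventually.of_forall fun y => Continuous.continuousAt ?_
      fun_prop
  · intro x x'
    refine (norm_integral_le_of_norm_le
      ((integrable_exp_neg_mul_norm_sub_R2 hδ x).const_mul _)
      (Eventually.of_forall fun y => hbound x y x')).trans_eq ?_
    rw [integral_const_mul,
      integral_sub_left_eq_self (fun y : R2 => Real.exp (-(β - β') * ‖y‖)) volume x]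
    ring

/-- The iterated kernels of a JCEL kernel are JCEL, with geometrically growing constants. -/
lemma JCEL.iterated {K : R2 × R2 → ℂ} {C β β' : ℝ} (hC : 0 ≤ C) (hβ' : 0 ≤ β') (hlt : β' < β)
    (hK : JCEL K C β) (n : ℕ) :
    JCEL (iterK K n) (C * (C * ∫ y : R2, Real.exp (-(β - β') * ‖y‖)) ^ n) β' := by
  have hM : 0 ≤ ∫ y : R2, Real.exp (-(β - β') * ‖y‖) :=
    integral_nonneg fun y => (Real.exp_pos _).le
  induction n with
  | zero =>
    refine ⟨hK.1, fun x x' => (hK.2 x x').trans ?_⟩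
    rw [pow_zero, mul_one]
    gcongr
  | succ n ih =>
    have h := JCEL.comp hC (by positivity) hβ' hlt hK ih
    rw [show C * (C * ∫ y : R2, Real.exp (-(β - β') * ‖y‖)) ^ (n + 1) =
      C * (C * (C * ∫ y : R2, Real.exp (-(β - β') * ‖y‖)) ^ n) *
        ∫ y : R2, Real.exp (-(β - β') * ‖y‖) by ring]
    exact h

/-- Proposition A.2(iii). For a JCEL kernel `K` with constants `(C, β)`,
`0 < β' < β`, `M := ∫ exp(−(β−β')·‖y‖) dy`, and coefficients `aₙ` (here `a n` is the
coefficient of `K⁽ⁿ⁺¹⁾ = iterK K n`) with `S := Σₙ |aₙ|·C·(C·M)ⁿ < ∞`, the series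
`F(x,x') := Σₙ aₙ·K⁽ⁿ⁺¹⁾(x,x')` converges absolutely and uniformly, is jointly continuous,
and satisfies `|F(x,x')| ≤ S·exp(−β'·‖x−x'‖)`. -/
theorem stmt_3 (K : R2 × R2 → ℂ) (C β : ℝ) (hC : 0 < C) (hβ : 0 < β)
    (hK : JCEL K C β) (β' : ℝ) (hβ'pos : 0 < β') (hβ'lt : β' < β)
    (M : ℝ) (hM : M = ∫ y : R2, Real.exp (-(β - β') * ‖y‖))
    (a : ℕ → ℂ) (hS : Summable (fun n : ℕ => ‖a n‖ * (C * (C * M) ^ n))) :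
    -- absolute convergence, everywhere
    (∀ p : R2 × R2, Summable (fun n : ℕ => ‖a n * iterK K n p‖)) ∧
    -- uniform convergence of the partial sums to the sum on ℝ² × ℝ²
    TendstoUniformly
      (fun (N : ℕ) (p : R2 × R2) => ∑ n ∈ Finset.range N, a n * iterK K n p)
      (fun p : R2 × R2 => ∑' n : ℕ, a n * iterK K n p) atTop ∧
    -- joint continuity of the sum
    Continuous (fun p : R2 × R2 => ∑' n : ℕ, a n * iterK K n p) ∧
    -- exponential localization of the sum
    (∀ x x' : R2,
      ‖∑' n : ℕ, a n * iterK K n (x, x')‖ ≤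
        (∑' n : ℕ, ‖a n‖ * (C * (C * M) ^ n)) * Real.exp (-β' * ‖x - x'‖)) := by
  subst hM
  have hiter := JCEL.iterated hC.le hβ'pos.le hβ'lt hK
  set M := ∫ y : R2, Real.exp (-(β - β') * ‖y‖)
  have hM : 0 ≤ M := integral_nonneg fun y => (Real.exp_pos _).le
  have hloc : ∀ (n : ℕ) (x x' : R2), ‖a n * iterK K n (x, x')‖ ≤
      ‖a n‖ * (C * (C * M) ^ n) * Real.exp (-β' * ‖x - x'‖) := by
    intro n x x'
    rw [norm_mul, mul_assoc]
    gcongr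
    exact (hiter n).2 x x'
  have hunif : ∀ (n : ℕ) (p : R2 × R2), ‖a n * iterK K n p‖ ≤ ‖a n‖ * (C * (C * M) ^ n) := by
    intro n p
    refine (hloc n p.1 p.2).trans (mul_le_of_le_one_right (by positivity) ?_)
    exact Real.exp_le_one_iff.2
      (mul_nonpos_of_nonpos_of_nonneg (neg_nonpos.2 hβ'pos.le) (norm_nonneg _))
  refine ⟨fun p => hS.of_nonneg_of_le (fun n => norm_nonneg _) fun n => hunif n p,
    tendstoUniformly_tsum_nat hS hunif,
    continuous_tsum (fun n => continuous_const.mul (hiter n).1) hS hunif, fun x x' => ?_⟩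
  exact tsum_of_norm_bounded (hS.hasSum.mul_right _) fun n => hloc n x x'
end
end

section
/- Let a₁, a₂ ∈ ℝ² be linearly independent vectors, let Γ := { m·a₁ + n·a₂ : m, n ∈ ℤ }, and let A : ℝ² → ℝ² be continuous. For γ ∈ Γ let T_γ be the bounded operator on L²(ℝ², ℂ) defined by (T_γ ψ)(x) := exp(−i·A(x)·γ)·ψ(x−γ). Let T be a bounded operator on L²(ℝ², ℂ) and K : ℝ² × ℝ² → ℂ a JCEL kernel such that for every f ∈ L²(ℝ², ℂ), (Tf)(x) = ∫_{ℝ²} K(x,y)·f(y) dy for almost every x. If T ∘ T_γ = T_γ ∘ T for every γ ∈ Γ, then K satisfies the magnetic periodicity condition (mpc) with respect to A and Γ, and in particular K(x+γ, x+γ) = K(x,x) for all x ∈ ℝ² and γ ∈ Γ. -/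
open MeasureTheory RealInnerProductSpace

noncomputable section

/-- The Hilbert space `L²(ℝ², ℂ)`. -/
abbrev L2 : Type := Lp ℂ 2 (volume : Measure R2)

/-- The lattice `Γ = ℤa₁ + ℤa₂` generated by `a₁, a₂ ∈ ℝ²`. -/
def lattice (a₁ a₂ : R2) : Set R2 := {γ | ∃ m n : ℤ, γ = m • a₁ + n • a₂}

/-- The magnetic periodicity condition (mpc) for a kernel `K` with respect to a vector
potential `A` and a lattice `Γ`. -/
def MPC (A : R2 → R2) (Γ : Set R2) (K : R2 × R2 → ℂ) : Prop :=
  ∀ γ ∈ Γ, ∀ x x' : R2,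
    Complex.exp (-Complex.I * (⟪A x, γ⟫ : ℝ)) * K (x - γ, x') =
      K (x, x' + γ) * Complex.exp (-Complex.I * (⟪A (x' + γ), γ⟫ : ℝ))

/-- Two continuous kernels whose partial integrals over every compact set agree almost everywhere
are equal. -/
theorem kernel_eq_of_setIntegral_isCompact_ae_eq {G H : R2 → R2 → ℂ}
    (hG : Continuous (Function.uncurry G)) (hH : Continuous (Function.uncurry H))
    (h : ∀ s : Set R2, IsCompact s → ∀ᵐ x : R2, ∫ y in s, G x y = ∫ y in s, H x y) :
    G = H := by
  have key : ∀ s : Set R2, IsCompact s → ∀ x : R2, ∫ y in s, G x y = ∫ y in s, H x y := by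
    intro s hs
    exact congrFun ((Continuous.ae_eq_iff_eq volume
      (continuous_parametric_integral_of_continuous hG hs)
      (continuous_parametric_integral_of_continuous hH hs)).1 (h s hs))
  funext x
  have hGx : Continuous (G x) := hG.comp (Continuous.prodMk_right x)
  have hHx : Continuous (H x) := hH.comp (Continuous.prodMk_right x)
  refine (Continuous.ae_eq_iff_eq volume hGx hHx).1 ?_
  have h0 : ∀ᵐ y : R2, (G x - H x) y = 0 := by
    refine ae_eq_zero_of_forall_setIntegral_isCompact_eq_zero'
      (hGx.sub hHx).locallyIntegrable fun s hs => ?_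
    simp only [Pi.sub_apply]
    rw [integral_sub (hGx.continuousOn.integrableOn_compact hs)
      (hHx.continuousOn.integrableOn_compact hs), key s hs x, sub_self]
  filter_upwards [h0] with y hy
  exact sub_eq_zero.1 hy

theorem integral_mul_indicatorConstLp_one {s : Set R2} (hs : MeasurableSet s)
    (hμs : volume s ≠ ⊤) (g : R2 → ℂ) :
    ∫ y : R2, g y * (indicatorConstLp 2 hs hμs (1 : ℂ) : R2 → ℂ) y = ∫ y in s, g y := by
  rw [← integral_indicator hs]
  refine integral_congr_ae ?_
  filter_upwards [indicatorConstLp_coeFn (p := 2) (hs := hs) (hμs := hμs) (c := (1 : ℂ))] with y hy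
  rw [hy]
  by_cases hys : y ∈ s <;> simp [hys]

/-- Remark C.1. Let `T_γ` be the magnetic translations,
`(T_γ ψ)(x) = exp(−i·A(x)·γ)·ψ(x−γ)`. If a bounded operator `T` on `L²(ℝ²,ℂ)` with JCEL
integral kernel `K` commutes with all `T_γ`, `γ ∈ Γ`, then `K` satisfies the mpc with
respect to `A` and `Γ`; in particular its diagonal is `Γ`-periodic. -/
theorem stmt_6 (a₁ a₂ : R2) (hlin : LinearIndependent ℝ ![a₁, a₂])
    (A : R2 → R2) (hA : Continuous A)
    (Tmag : R2 → (L2 →L[ℂ] L2))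
    (hTmag : ∀ γ ∈ lattice a₁ a₂, ∀ ψ : L2, ∀ᵐ x : R2,
      (Tmag γ ψ : R2 → ℂ) x =
        Complex.exp (-Complex.I * (⟪A x, γ⟫ : ℝ)) * (ψ : R2 → ℂ) (x - γ))
    (T : L2 →L[ℂ] L2) (K : R2 × R2 → ℂ) (C β : ℝ) (hC : 0 < C) (hβ : 0 < β)
    (hK : JCEL K C β)
    (hker : ∀ f : L2, ∀ᵐ x : R2,
      (T f : R2 → ℂ) x = ∫ y : R2, K (x, y) * (f : R2 → ℂ) y)
    (hcomm : ∀ γ ∈ lattice a₁ a₂, T ∘L Tmag γ = Tmag γ ∘L T) :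
    MPC A (lattice a₁ a₂) K ∧
    ∀ γ ∈ lattice a₁ a₂, ∀ x : R2, K (x + γ, x + γ) = K (x, x) := by
  have hmpc : MPC A (lattice a₁ a₂) K := by
    intro γ hγ x x'
    have hKc : Continuous K := hK.1
    refine congrFun (congrFun (kernel_eq_of_setIntegral_isCompact_ae_eq
      (G := fun x y => Complex.exp (-Complex.I * (⟪A x, γ⟫ : ℝ)) * K (x - γ, y))
      (H := fun x y => K (x, y + γ) * Complex.exp (-Complex.I * (⟪A (y + γ), γ⟫ : ℝ)))
      (by unfold Function.uncurry; fun_prop) (by unfold Function.uncurry; fun_prop)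
      fun s hs => ?_) x) x'
    set f : L2 := indicatorConstLp 2 hs.measurableSet hs.measure_lt_top.ne (1 : ℂ) with hf
    have hcf : T (Tmag γ f) = Tmag γ (T f) := DFunLike.congr_fun (hcomm γ hγ) f
    have hshift : ∀ᵐ x : R2, (T f : R2 → ℂ) (x - γ) =
        ∫ y : R2, K (x - γ, y) * (f : R2 → ℂ) y :=
      (measurePreserving_sub_right volume γ).quasiMeasurePreserving.ae (hker f)
    filter_upwards [hker (Tmag γ f), hTmag γ hγ (T f), hshift] with x h₁ h₂ h₃
    rw [hcf, h₂, h₃, hf, integral_mul_indicatorConstLp_one] at h₁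
    rw [integral_const_mul, h₁, ← integral_mul_indicatorConstLp_one hs.measurableSet
      hs.measure_lt_top.ne, ← hf]
    calc ∫ y : R2, K (x, y) * (Tmag γ f : R2 → ℂ) y
        = ∫ y : R2, K (x, y) * (Complex.exp (-Complex.I * (⟪A y, γ⟫ : ℝ)) *
            (f : R2 → ℂ) (y - γ)) := by
          refine integral_congr_ae ?_
          filter_upwards [hTmag γ hγ f] with y hy
          rw [hy]
      _ = _ := by
          rw [← integral_add_right_eq_self _ γ]
          simp only [add_sub_cancel_right, mul_assoc]
  refine ⟨hmpc, fun γ hγ x => ?_⟩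
  have h := hmpc γ hγ (x + γ) x
  rw [add_sub_cancel_right, mul_comm] at h
  exact (mul_right_cancel₀ (Complex.exp_ne_zero _) h).symm
end
end

section
/- Let a₁, a₂ ∈ ℝ² be linearly independent vectors, let Γ := { m·a₁ + n·a₂ : m, n ∈ ℤ }, and let A : ℝ² → ℝ² be any function. Let K₁, K₂ : ℝ² × ℝ² → ℂ be JCEL kernels, each satisfying the magnetic periodicity condition (mpc) with respect to A and Γ. Then the composed kernel (K₁ ∘ K₂)(x,x') := ∫_{ℝ²} K₁(x,y)·K₂(y,x') dy also satisfies the mpc with respect to A and Γ. -/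
open MeasureTheory RealInnerProductSpace

noncomputable section

/-- Composition of kernels: `(K₁ ∘ K₂)(x,x') = ∫ K₁(x,y)·K₂(y,x') dy`. -/
noncomputable def compK (K₁ K₂ : R2 × R2 → ℂ) : R2 × R2 → ℂ :=
  fun p => ∫ y : R2, K₁ (p.1, y) * K₂ (y, p.2)

/-- part of Corollary A.3. If two JCEL kernels `K₁`, `K₂` both satisfy the
mpc with respect to `A` and `Γ`, then so does their composition `K₁ ∘ K₂`. -/
theorem stmt_7 (a₁ a₂ : R2) (hlin : LinearIndependent ℝ ![a₁, a₂])
    (A : R2 → R2) (K₁ K₂ : R2 × R2 → ℂ) (C₁ β₁ C₂ β₂ : ℝ)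
    (hC₁ : 0 < C₁) (hβ₁ : 0 < β₁) (hC₂ : 0 < C₂) (hβ₂ : 0 < β₂)
    (h₁ : JCEL K₁ C₁ β₁) (h₂ : JCEL K₂ C₂ β₂)
    (h₁mpc : MPC A (lattice a₁ a₂) K₁) (h₂mpc : MPC A (lattice a₁ a₂) K₂) :
    MPC A (lattice a₁ a₂) (compK K₁ K₂) := by
  intro γ hγ x x'
  simp only [compK]
  rw [← integral_add_right_eq_self (fun y => K₁ (x, y) * K₂ (y, x' + γ)) γ,
    ← integral_const_mul, ← integral_mul_const]
  refine integral_congr_ae (.of_forall fun y => ?_)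
  have e₁ := h₁mpc γ hγ x y
  have e₂ := h₂mpc γ hγ (y + γ) x'
  rw [add_sub_cancel_right] at e₂
  linear_combination K₂ (y, x') * e₁ + K₁ (x, y + γ) * e₂
end
end

section
/- Let β, β_T, C, C_T > 0 and fix β' with 0 < β' < min(β, β_T). Let r, s, t : ℝ² × ℝ² → ℂ be measurable and satisfy: sup_{x ∈ ℝ²} ( ∫_{ℝ²} |r(x,y)|²·exp(2β·‖x−y‖) dy )^{1/2} ≤ C, sup_{x' ∈ ℝ²} ( ∫_{ℝ²} |s(y,x')|²·exp(2β·‖y−x'‖) dy )^{1/2} ≤ C, and |t(y,y')| ≤ C_T·exp(−β_T·‖y−y'‖) for all y, y' ∈ ℝ². Then there exists a constant C' > 0, depending only on C, C_T, β, β_T, β', such that for all x, x' ∈ ℝ² the double integral converges absolutely and | ∫_{ℝ²}∫_{ℝ²} r(x,y)·t(y,y')·s(y',x') dy dy' | ≤ C'·exp(−β'·‖x−x'‖). -/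
open MeasureTheory

noncomputable section

theorem integrable_exp_neg_mul_norm_s19 {E : Type*} [NormedAddCommGroup E] [NormedSpace ℝ E]
    [FiniteDimensional ℝ E] [MeasurableSpace E] [BorelSpace E] (μ : Measure E)
    [μ.IsAddHaarMeasure] {δ : ℝ} (hδ : 0 < δ) :
    Integrable (fun z : E => Real.exp (-δ * ‖z‖)) μ := by
  set n := Module.finrank ℝ E + 1 with hn
  have hint : Integrable (fun z : E => (1 + ‖z‖) ^ (-(n : ℝ))) μ :=
    integrable_one_add_norm (by rw [hn]; push_cast; linarith)
  refine (hint.const_mul (n.factorial / δ ^ n * Real.exp δ)).mono'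
    (by fun_prop) (.of_forall fun z => ?_)
  have hpos : 0 < 1 + ‖z‖ := by positivity
  have h := Real.pow_div_factorial_le_exp (δ * (1 + ‖z‖)) (by positivity) n
  rw [Real.norm_of_nonneg (Real.exp_nonneg _), Real.rpow_neg hpos.le, Real.rpow_natCast]
  have hexp : Real.exp (-δ * ‖z‖) = Real.exp δ / Real.exp (δ * (1 + ‖z‖)) := by
    rw [← Real.exp_sub]
    congr 1
    ring
  calc Real.exp (-δ * ‖z‖) = Real.exp δ / Real.exp (δ * (1 + ‖z‖)) := hexp
    _ ≤ Real.exp δ / ((δ * (1 + ‖z‖)) ^ n / n.factorial) := by gcongr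
    _ = n.factorial / δ ^ n * Real.exp δ * ((1 + ‖z‖) ^ n)⁻¹ := by
      rw [mul_pow]
      field_simp

section Convolution

variable {G : Type*} [AddCommGroup G] [MeasurableSpace G] [MeasurableAdd₂ G] [MeasurableNeg G]
  {μ : Measure G} [SFinite μ] [μ.IsAddLeftInvariant]

theorem lintegral_prod_fst_mul_sub [μ.IsNegInvariant] {f k : G → ENNReal} (hf : Measurable f)
    (hk : Measurable k) :
    ∫⁻ q : G × G, f q.1 * k (q.1 - q.2) ∂(μ.prod μ) = (∫⁻ y, f y ∂μ) * ∫⁻ z, k z ∂μ := by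
  rw [lintegral_prod _ (by fun_prop)]
  have h (y : G) : ∫⁻ y', f y * k (y - y') ∂μ = f y * ∫⁻ z, k z ∂μ := by
    rw [lintegral_const_mul _ (by fun_prop), lintegral_sub_left_eq_self k y]
  simp only [h]
  exact lintegral_mul_const _ hf

theorem lintegral_prod_snd_mul_sub {f k : G → ENNReal} (hf : Measurable f)
    (hk : Measurable k) :
    ∫⁻ q : G × G, f q.2 * k (q.1 - q.2) ∂(μ.prod μ) = (∫⁻ y, f y ∂μ) * ∫⁻ z, k z ∂μ := by
  rw [lintegral_prod_symm _ (by fun_prop)]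
  have h (y' : G) : ∫⁻ y, f y' * k (y - y') ∂μ = f y' * ∫⁻ z, k z ∂μ := by
    rw [lintegral_const_mul _ (by fun_prop), lintegral_sub_right_eq_self k y']
  simp only [h]
  exact lintegral_mul_const _ hf

end Convolution

/-- Pointwise bound on a product of localized amplitudes: the triangle inequality extracts the
decay between the endpoints, and the arithmetic-geometric mean inequality splits the rest. -/
theorem mul_mul_le_exp_mul_weighted_sq {E : Type*} [NormedAddCommGroup E]
    {a b τ CT β βT β' : ℝ} {x x' y y' : E} (ha : 0 ≤ a) (hb : 0 ≤ b) (hCT : 0 ≤ CT)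
    (hβ' : 0 ≤ β') (hβ : β' ≤ β) (hτ : τ ≤ CT * Real.exp (-βT * ‖y - y'‖)) :
    a * τ * b ≤ CT * Real.exp (-β' * ‖x - x'‖) / 2 *
      (a ^ 2 * Real.exp (2 * β * ‖x - y‖) * Real.exp (-(βT - β') * ‖y - y'‖) +
        b ^ 2 * Real.exp (2 * β * ‖y' - x'‖) * Real.exp (-(βT - β') * ‖y - y'‖)) := by
  have htri : ‖x - x'‖ ≤ ‖x - y‖ + ‖y - y'‖ + ‖y' - x'‖ := by
    have h : x - x' = (x - y) + (y - y') + (y' - x') := by abel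
    rw [h]
    exact norm_add₃_le
  have hexp : Real.exp (-βT * ‖y - y'‖) ≤ Real.exp (-β' * ‖x - x'‖) *
      (Real.exp (β * ‖x - y‖) * Real.exp (β * ‖y' - x'‖) *
        Real.exp (-(βT - β') * ‖y - y'‖)) := by
    simp only [← Real.exp_add]
    apply Real.exp_le_exp.2
    nlinarith [mul_le_mul_of_nonneg_left htri hβ',
      mul_le_mul_of_nonneg_right hβ (norm_nonneg (x - y)),
      mul_le_mul_of_nonneg_right hβ (norm_nonneg (y' - x'))]
  have hsq (u : ℝ) : Real.exp (2 * β * u) = Real.exp (β * u) ^ 2 := by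
    rw [← Real.exp_nat_mul]
    congr 1
    push_cast
    ring
  rw [hsq, hsq]
  set p := Real.exp (β * ‖x - y‖)
  set q := Real.exp (β * ‖y' - x'‖)
  set k := Real.exp (-(βT - β') * ‖y - y'‖) with hk
  set e := Real.exp (-β' * ‖x - x'‖) with he
  have hk0 : 0 ≤ k := (Real.exp_pos _).le
  have he0 : 0 ≤ e := (Real.exp_pos _).le
  calc a * τ * b ≤ a * (CT * (e * (p * q * k))) * b := by
        gcongr
        exact hτ.trans (by gcongr)
    _ = CT * e / 2 * k * (2 * (a * p) * (b * q)) := by ring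
    _ ≤ CT * e / 2 * k * ((a * p) ^ 2 + (b * q) ^ 2) := by
        gcongr
        exact two_mul_le_add_sq _ _
    _ = _ := by ring

/-- kernel estimate from the proof of Proposition B.3(iii). Sandwiching
an exponentially localized kernel `t` between two kernels `r`, `s` satisfying `L²`-type
Combes–Thomas bounds produces an exponentially localized kernel: there exists `C' > 0`,
depending only on `C, C_T, β, β_T, β'`, such that for all admissible `r, s, t` and all
`x, x'`, the double integral converges absolutely and
`|∫∫ r(x,y)·t(y,y')·s(y',x') dy dy'| ≤ C'·exp(−β'·‖x−x'‖)`. -/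
theorem stmt_19 (C CT β βT : ℝ) (hC : 0 < C) (hCT : 0 < CT) (hβ : 0 < β)
    (hβT : 0 < βT) (β' : ℝ) (hβ'pos : 0 < β') (hβ'lt : β' < min β βT) :
    ∃ C' : ℝ, 0 < C' ∧
      ∀ r s t : R2 × R2 → ℂ,
        Measurable r → Measurable s → Measurable t →
        (∀ x : R2,
          (∫⁻ y : R2, ENNReal.ofReal (‖r (x, y)‖ ^ 2 * Real.exp (2 * β * ‖x - y‖))) ≤
            ENNReal.ofReal (C ^ 2)) →
        (∀ x' : R2,
          (∫⁻ y : R2, ENNReal.ofReal (‖s (y, x')‖ ^ 2 * Real.exp (2 * β * ‖y - x'‖))) ≤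
            ENNReal.ofReal (C ^ 2)) →
        (∀ y y' : R2, ‖t (y, y')‖ ≤ CT * Real.exp (-βT * ‖y - y'‖)) →
        ∀ x x' : R2,
          Integrable
            (fun q : R2 × R2 => r (x, q.1) * t (q.1, q.2) * s (q.2, x')) ∧
          ‖∫ q : R2 × R2, r (x, q.1) * t (q.1, q.2) * s (q.2, x')‖ ≤
            C' * Real.exp (-β' * ‖x - x'‖) := by
  set δ := βT - β' with hδ_def
  have hδ : 0 < δ := sub_pos.2 (hβ'lt.trans_le (min_le_right _ _))
  have hββ' : β' ≤ β := (hβ'lt.trans_le (min_le_left _ _)).le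
  have hkint := integrable_exp_neg_mul_norm_s19 (volume : Measure R2) hδ
  set K := ∫ z : R2, Real.exp (-δ * ‖z‖) with hK
  have hK0 : 0 ≤ K := integral_nonneg fun z => (Real.exp_pos _).le
  have hKeq : ∫⁻ z : R2, ENNReal.ofReal (Real.exp (-δ * ‖z‖)) = ENNReal.ofReal K :=
    (ofReal_integral_eq_lintegral_ofReal hkint (.of_forall fun z => (Real.exp_pos _).le)).symm
  refine ⟨CT * (C ^ 2 * K) + 1, by positivity, fun r s t hr hs ht hrC hsC htC x x' => ?_⟩
  set F : R2 × R2 → ℂ := fun q => r (x, q.1) * t (q.1, q.2) * s (q.2, x') with hF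
  have hFm : Measurable F := by fun_prop
  set e := Real.exp (-β' * ‖x - x'‖) with he
  have he0 : 0 < e := Real.exp_pos _
  set f : R2 → ℝ := fun y => ‖r (x, y)‖ ^ 2 * Real.exp (2 * β * ‖x - y‖) with hf
  set g : R2 → ℝ := fun y => ‖s (y, x')‖ ^ 2 * Real.exp (2 * β * ‖y - x'‖) with hg
  set k : R2 → ℝ := fun z => Real.exp (-δ * ‖z‖) with hk
  have hfm : Measurable f := by fun_prop
  have hgm : Measurable g := by fun_prop
  have hkm : Measurable k := by fun_prop
  have hf0 (y : R2) : 0 ≤ f y := by positivity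
  have hg0 (y : R2) : 0 ≤ g y := by positivity
  have hk0 (y : R2) : 0 ≤ k y := by positivity
  have hpt (q : R2 × R2) : ENNReal.ofReal ‖F q‖ ≤ ENNReal.ofReal (CT * e / 2) *
      (ENNReal.ofReal (f q.1) * ENNReal.ofReal (k (q.1 - q.2)) +
        ENNReal.ofReal (g q.2) * ENNReal.ofReal (k (q.1 - q.2))) := by
    rw [← ENNReal.ofReal_mul (hf0 _), ← ENNReal.ofReal_mul (hg0 _),
      ← ENNReal.ofReal_add (mul_nonneg (hf0 _) (hk0 _)) (mul_nonneg (hg0 _) (hk0 _)),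
      ← ENNReal.ofReal_mul (by positivity)]
    apply ENNReal.ofReal_le_ofReal
    rw [hF, norm_mul, norm_mul]
    exact mul_mul_le_exp_mul_weighted_sq (norm_nonneg _) (norm_nonneg _) hCT.le hβ'pos.le hββ'
      (htC _ _)
  have hbound : ∫⁻ q, ENNReal.ofReal ‖F q‖ ≤ ENNReal.ofReal (CT * (C ^ 2 * K) * e) := by
    calc ∫⁻ q, ENNReal.ofReal ‖F q‖
        ≤ ∫⁻ q : R2 × R2, ENNReal.ofReal (CT * e / 2) *
            (ENNReal.ofReal (f q.1) * ENNReal.ofReal (k (q.1 - q.2)) +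
              ENNReal.ofReal (g q.2) * ENNReal.ofReal (k (q.1 - q.2))) := lintegral_mono hpt
      _ = ENNReal.ofReal (CT * e / 2) * ((∫⁻ y, ENNReal.ofReal (f y)) * ENNReal.ofReal K +
            (∫⁻ y, ENNReal.ofReal (g y)) * ENNReal.ofReal K) := by
          rw [lintegral_const_mul _ (by fun_prop), lintegral_add_left (by fun_prop), ← hKeq,
            Measure.volume_eq_prod,
            lintegral_prod_fst_mul_sub (f := fun y => ENNReal.ofReal (f y))
              (k := fun z => ENNReal.ofReal (k z)) (by fun_prop) (by fun_prop),
            lintegral_prod_snd_mul_sub (f := fun y => ENNReal.ofReal (g y))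
              (k := fun z => ENNReal.ofReal (k z)) (by fun_prop) (by fun_prop)]
      _ ≤ ENNReal.ofReal (CT * e / 2) * (ENNReal.ofReal (C ^ 2) * ENNReal.ofReal K +
            ENNReal.ofReal (C ^ 2) * ENNReal.ofReal K) := by
          gcongr
          · exact hrC x
          · exact hsC x'
      _ = ENNReal.ofReal (CT * (C ^ 2 * K) * e) := by
          rw [← ENNReal.ofReal_mul (by positivity),
            ← ENNReal.ofReal_add (by positivity) (by positivity),
            ← ENNReal.ofReal_mul (by positivity)]
          congr 1
          ring
  refine ⟨⟨hFm.aestronglyMeasurable, ?_⟩, ?_⟩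
  · rw [hasFiniteIntegral_iff_norm]
    exact hbound.trans_lt ENNReal.ofReal_lt_top
  · calc ‖∫ q, F q‖ ≤ (∫⁻ q, ENNReal.ofReal ‖F q‖).toReal := norm_integral_le_lintegral_norm _
      _ ≤ CT * (C ^ 2 * K) * e := ENNReal.toReal_le_of_le_ofReal (by positivity) hbound
      _ ≤ (CT * (C ^ 2 * K) + 1) * e := by gcongr; linarith
end
end
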